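/- Let f be an expanding Lorenz map with critical point c, let κ > 1, let O be a c-free periodic orbit of f of period κ, and suppose f has no c-free periodic point of period strictly less than κ. Then O contains points on both sides of c, and with P_L = max{x ∈ O : x < c} and P_R = min{x ∈ O : x > c} one has N((P_L, c)) = N((c, P_R)) = κ. -/

import Mathlib

open Set Filter Topology Function

/-- `f` is an expanding Lorenz map on `[a,b]` with critical point `c`:
continuous and strictly increasing on `[a,c)` and `(c,b]`, with
`lim_{x→c⁻} f(x) = b`, `lim_{x→c⁺} f(x) = a`, and differentiable with
derivative uniformly greater than `1` outside a finite set. -/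
structure IsExpandingLorenzOn (f : ℝ → ℝ) (c a b : ℝ) : Prop where
  a_lt_c : a < c
  c_lt_b : c < b
  mapsTo : Set.MapsTo f (Set.Icc a b) (Set.Icc a b)
  mono_left : StrictMonoOn f (Set.Ico a c)
  mono_right : StrictMonoOn f (Set.Ioc c b)
  cont_left : ContinuousOn f (Set.Ico a c)
  cont_right : ContinuousOn f (Set.Ioc c b)
  lim_left : Filter.Tendsto f (nhdsWithin c (Set.Iio c)) (nhds b)
  lim_right : Filter.Tendsto f (nhdsWithin c (Set.Ioi c)) (nhds a)
  expanding : ∃ F : Set ℝ, F.Finite ∧ ∃ lam : ℝ, 1 < lam ∧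
    ∀ x ∈ Set.Icc a b \ F, ∃ d : ℝ, HasDerivWithinAt f d (Set.Icc a b) x ∧ lam ≤ d

/-- An expanding Lorenz map on `[0,1]` with critical point `c`. -/
def IsExpandingLorenz (f : ℝ → ℝ) (c : ℝ) : Prop := IsExpandingLorenzOn f c 0 1

/-- A primary `n(k)`-cycle `z 0 < z 1 < ⋯ < z (n-k-1) < c < z (n-k) < ⋯ < z (n-1)`
for a Lorenz map `f` with critical point `c`. -/
structure IsPrimaryCycle (f : ℝ → ℝ) (c : ℝ) (n k : ℕ) (z : ℕ → ℝ) : Prop where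
  k_pos : 0 < k
  k_lt_n : k < n
  coprime : Nat.Coprime n k
  mem : ∀ i < n, z i ∈ Set.Icc (0:ℝ) 1
  mono : ∀ i j : ℕ, i < j → j < n → z i < z j
  left_of_c : ∀ i < n - k, z i < c
  right_of_c : ∀ i : ℕ, n - k ≤ i → i < n → c < z i
  step : ∀ i < n, f (z i) = z ((i + k) % n)
  le_f0 : z (k - 1) ≤ f 0
  f1_le : f 1 ≤ z k

/-- `g` is a renormalization `(f^l, f^r)` of the Lorenz map `f` on the
renormalization interval `[u,v]`: on `[u,c)` (resp. `(c,v]`) the map `g`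
is given by `f^[l]` (resp. `f^[r]`), with values given by one-sided limits
at points where some earlier iterate hits `c`, and `g` is itself an
expanding Lorenz map on `[u,v]` with critical point `c`. -/
structure IsRenormalization (f : ℝ → ℝ) (c : ℝ) (l r : ℕ) (u v : ℝ) (g : ℝ → ℝ) : Prop where
  one_lt_l : 1 < l
  one_lt_r : 1 < r
  u_nonneg : 0 ≤ u
  u_lt_c : u < c
  c_lt_v : c < v
  v_le_one : v ≤ 1
  proper : 0 < u ∨ v < 1
  eq_left : ∀ x ∈ Set.Ico u c, (∀ i < l, f^[i] x ≠ c) → g x = f^[l] x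
  eq_right : ∀ x ∈ Set.Ioc c v, (∀ i < r, f^[i] x ≠ c) → g x = f^[r] x
  lim_left_pt : ∀ x ∈ Set.Ico u c,
    Filter.Tendsto (f^[l]) (nhdsWithin x (Set.Ioi x)) (nhds (g x))
  lim_right_pt : ∀ x ∈ Set.Ioc c v,
    Filter.Tendsto (f^[r]) (nhdsWithin x (Set.Iio x)) (nhds (g x))
  lim_c_left : Filter.Tendsto (f^[l]) (nhdsWithin c (Set.Iio c)) (nhds v)
  lim_c_right : Filter.Tendsto (f^[r]) (nhdsWithin c (Set.Ioi c)) (nhds u)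
  lorenz : IsExpandingLorenzOn g c u v

/-- The forward orbit of `x` enters the set `S` with a `c`-free prefix:
there is `n ≥ 0` with `f^[i] x ≠ c` for `0 ≤ i < n` and `f^[n] x ∈ S`. -/
def CFreeEnters (f : ℝ → ℝ) (c : ℝ) (S : Set ℝ) (x : ℝ) : Prop :=
  ∃ n : ℕ, (∀ i < n, f^[i] x ≠ c) ∧ f^[n] x ∈ S

/-- `N(U) = min {n ≥ 0 : f^[n] z = c for some z ∈ U}`. -/
noncomputable def hitTime (f : ℝ → ℝ) (c : ℝ) (U : Set ℝ) : ℕ :=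
  sInf {n : ℕ | ∃ z ∈ U, f^[n] z = c}

/-- `x ∈ [0,1]` is a `c`-free periodic point of `f` of (exact) period `p`. -/
def IsCFreePeriodic (f : ℝ → ℝ) (c x : ℝ) (p : ℕ) : Prop :=
  x ∈ Set.Icc (0:ℝ) 1 ∧ f^[p] x = x ∧ (∀ i : ℕ, 0 < i → i < p → f^[i] x ≠ x) ∧
    ∀ i < p, f^[i] x ≠ c

/-- Topological transitivity of `f` as a map of `[0,1]`. -/
def LorenzTransitive (f : ℝ → ℝ) : Prop :=
  ∀ U V : Set ℝ, IsOpen U → IsOpen V →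
    (U ∩ Set.Icc 0 1).Nonempty → (V ∩ Set.Icc 0 1).Nonempty →
    ∃ n : ℕ, (f^[n] '' (U ∩ Set.Icc 0 1) ∩ (V ∩ Set.Icc 0 1)).Nonempty

/-- `f` is locally eventually onto: every nonempty (relatively) open subset of `[0,1]`
contains open intervals mapped homeomorphically onto `(0,c)` and onto `(c,1)`
by suitable iterates of `f`. -/
def LocallyEventuallyOnto (f : ℝ → ℝ) (c : ℝ) : Prop :=
  ∀ U : Set ℝ, IsOpen U → (U ∩ Set.Icc 0 1).Nonempty →
    (∃ a b : ℝ, a < b ∧ Set.Ioo a b ⊆ U ∩ Set.Icc 0 1 ∧ ∃ n : ℕ,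
      ContinuousOn (f^[n]) (Set.Ioo a b) ∧ Set.InjOn (f^[n]) (Set.Ioo a b) ∧
        f^[n] '' Set.Ioo a b = Set.Ioo 0 c) ∧
    (∃ a b : ℝ, a < b ∧ Set.Ioo a b ⊆ U ∩ Set.Icc 0 1 ∧ ∃ n : ℕ,
      ContinuousOn (f^[n]) (Set.Ioo a b) ∧ Set.InjOn (f^[n]) (Set.Ioo a b) ∧
        f^[n] '' Set.Ioo a b = Set.Ioo c 1)

/-- The generalized backward orbit of `x`: points joined to `x` by a chain
following `f`, where at the critical point `c` the chain may continue with
either `0` or `1`. -/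
def GenBackwardOrbit (f : ℝ → ℝ) (c x : ℝ) : Set ℝ :=
  {y | y ∈ Set.Icc (0:ℝ) 1 ∧ ∃ (k : ℕ) (w : ℕ → ℝ), w 0 = y ∧ w k = x ∧
    ∀ i < k, (w i ≠ c → w (i + 1) = f (w i)) ∧ (w i = c → w (i + 1) = 0 ∨ w (i + 1) = 1)}
/-- A lower bound on the derivative off a finite set bounds the increment from below. -/
theorem mul_sub_le_image_sub_of_hasDerivAt_off_finite {f : ℝ → ℝ} {lam : ℝ} {F : Set ℝ}
    (hF : F.Finite) : ∀ u v : ℝ, u ≤ v → ContinuousOn f (Icc u v) →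
      (∀ x ∈ Ioo u v \ F, ∃ d, HasDerivAt f d x ∧ lam ≤ d) → lam * (v - u) ≤ f v - f u := by
  induction F, hF using Set.Finite.induction_on with
  | empty =>
    intro u v huv hc hd
    have hd' : ∀ x ∈ interior (Icc u v), ∃ d, HasDerivAt f d x ∧ lam ≤ d := fun x hx =>
      hd x ⟨by rwa [interior_Icc] at hx, notMem_empty x⟩
    refine (convex_Icc u v).mul_sub_le_image_sub_of_le_deriv hc ?_ ?_ u (left_mem_Icc.2 huv) v
      (right_mem_Icc.2 huv) huv
    · intro x hx
      obtain ⟨d, hd, -⟩ := hd' x hx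
      exact hd.differentiableAt.differentiableWithinAt
    · intro x hx
      obtain ⟨d, hd, hle⟩ := hd' x hx
      rwa [hd.deriv]
  | @insert a s _ _ ih =>
    intro u v huv hc hd
    by_cases ha : a ∈ Ioo u v
    · have h₁ := ih u a ha.1.le (hc.mono (Icc_subset_Icc_right ha.2.le)) fun x hx =>
        hd x ⟨⟨hx.1.1, hx.1.2.trans ha.2⟩, by
          rintro (rfl | h)
          exacts [lt_irrefl _ hx.1.2, hx.2 h]⟩
      have h₂ := ih a v ha.2.le (hc.mono (Icc_subset_Icc_left ha.1.le)) fun x hx =>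
        hd x ⟨⟨ha.1.trans hx.1.1, hx.1.2⟩, by
          rintro (rfl | h)
          exacts [lt_irrefl _ hx.1.1, hx.2 h]⟩
      linarith
    · refine ih u v huv hc fun x hx => hd x ⟨hx.1, ?_⟩
      rintro (rfl | h)
      exacts [ha hx.1, hx.2 h]

namespace IsExpandingLorenz

variable {f : ℝ → ℝ} {c : ℝ}

theorem continuousOn_Icc (hf : IsExpandingLorenz f c) {u v : ℝ} (hu : 0 ≤ u) (hv : v ≤ 1)
    (hc : c ∉ Icc u v) : ContinuousOn f (Icc u v) := by
  by_cases hcu : c < u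
  · exact hf.cont_right.mono fun x hx => ⟨hcu.trans_le hx.1, hx.2.trans hv⟩
  · have hvc : v < c := not_le.1 fun h => hc ⟨not_lt.1 hcu, h⟩
    exact hf.cont_left.mono fun x hx => ⟨hu.trans hx.1, hx.2.trans_lt hvc⟩

/-- Iterates of an expanding Lorenz map are continuous and expanding on every interval that
does not meet the critical point too early. -/
theorem exists_expansion (hf : IsExpandingLorenz f c) : ∃ lam : ℝ, 1 < lam ∧
    ∀ (n : ℕ) (u v : ℝ), 0 ≤ u → u ≤ v → v ≤ 1 → (∀ i < n, ∀ z ∈ Icc u v, f^[i] z ≠ c) →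
      ContinuousOn f^[n] (Icc u v) ∧ lam ^ n * (v - u) ≤ f^[n] v - f^[n] u := by
  obtain ⟨F, hF, lam, hlam, hd⟩ := hf.expanding
  refine ⟨lam, hlam, fun n => ?_⟩
  induction n with
  | zero => exact fun u v _ _ _ _ => ⟨continuousOn_id, by simp⟩
  | succ n ih =>
    intro u v hu huv hv hc
    have hcont := hf.continuousOn_Icc hu hv fun h => hc 0 n.succ_pos c h rfl
    have hexp : ∀ w ∈ Icc u v, ∀ z ∈ Icc u v, w ≤ z → lam * (z - w) ≤ f z - f w := by
      intro w hw z hz hwz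
      refine mul_sub_le_image_sub_of_hasDerivAt_off_finite hF w z hwz
        (hcont.mono (Icc_subset_Icc hw.1 hz.2)) fun y hy => ?_
      have h0 : 0 < y := (hu.trans hw.1).trans_lt hy.1.1
      have h1 : y < 1 := hy.1.2.trans_le (hz.2.trans hv)
      obtain ⟨d, hd, hle⟩ := hd y ⟨⟨h0.le, h1.le⟩, hy.2⟩
      exact ⟨d, hd.hasDerivAt (Icc_mem_nhds h0 h1), hle⟩
    have hmono : MonotoneOn f (Icc u v) := fun w hw z hz hwz => by
      have := hexp w hw z hz hwz
      nlinarith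
    have hl := left_mem_Icc.2 huv
    have hr := right_mem_Icc.2 huv
    obtain ⟨hcn, hen⟩ := ih (f u) (f v) (hf.mapsTo ⟨hu, huv.trans hv⟩).1 (hmono hl hr huv)
      (hf.mapsTo ⟨hu.trans huv, hv⟩).2 (by
        intro i hi y hy
        obtain ⟨z, hz, rfl⟩ := intermediate_value_Icc huv hcont hy
        exact hc (i + 1) (Nat.succ_lt_succ hi) z hz)
    refine ⟨?_, ?_⟩
    · rw [iterate_succ]
      exact hcn.comp hcont fun z hz =>
        ⟨hmono hl hz hz.1, hmono hz hr hz.2⟩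
    · rw [iterate_succ_apply, iterate_succ_apply, pow_succ, mul_assoc]
      exact (mul_le_mul_of_nonneg_left (hexp u hl v hr huv)
        (pow_nonneg (zero_le_one.trans hlam.le) n)).trans hen

end IsExpandingLorenz

theorem StrictMonoOn.apply_eq_of_isPeriodicPt {α : Type*} [LinearOrder α] {f : α → α} {s : Set α}
    (hf : StrictMonoOn f s) {x : α} {n : ℕ} (hn : 0 < n) (hx : IsPeriodicPt f n x)
    (hs : ∀ i, f^[i] x ∈ s) : f x = x := by
  rcases lt_trichotomy x (f x) with h | h | h
  · have hlt : ∀ i, f^[i] x < f^[i + 1] x := fun i => by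
      induction i with
      | zero => exact h
      | succ i ih =>
        have := hf (hs i) (hs (i + 1)) ih
        rwa [← iterate_succ_apply' f, ← iterate_succ_apply' f] at this
    exact absurd hx (strictMono_nat_of_lt_succ (f := fun i => f^[i] x) hlt hn).ne'
  · exact h.symm
  · have hlt : ∀ i, f^[i + 1] x < f^[i] x := fun i => by
      induction i with
      | zero => exact h
      | succ i ih =>
        have := hf (hs (i + 1)) (hs i) ih
        rwa [← iterate_succ_apply' f, ← iterate_succ_apply' f] at this
    exact absurd hx (strictAnti_nat_of_succ_lt (f := fun i => f^[i] x) hlt hn).ne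

namespace IsCFreePeriodic

variable {f : ℝ → ℝ} {c x : ℝ} {κ : ℕ}

theorem isPeriodicPt (hx : IsCFreePeriodic f c x κ) : IsPeriodicPt f κ x := hx.2.1

theorem iterate_mod (hx : IsCFreePeriodic f c x κ) (i : ℕ) : f^[i % κ] x = f^[i] x :=
  hx.isPeriodicPt.iterate_mod_apply i

theorem iterate_ne (hx : IsCFreePeriodic f c x κ) (hκ : 0 < κ) (i : ℕ) : f^[i] x ≠ c :=
  hx.iterate_mod i ▸ hx.2.2.2 _ (Nat.mod_lt _ hκ)

theorem iterate (hx : IsCFreePeriodic f c x κ) (hf : MapsTo f (Icc 0 1) (Icc 0 1))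
    {j : ℕ} (hj : j < κ) : IsCFreePeriodic f c (f^[j] x) κ := by
  refine ⟨hf.iterate j hx.1, hx.isPeriodicPt.apply_iterate j, fun i hi hiκ h => ?_, fun i _ => ?_⟩
  · refine hx.2.2.1 i hi hiκ ?_
    have := congrArg f^[κ - j] h
    rwa [← iterate_add_apply, ← iterate_add_apply, ← iterate_add_apply,
      Nat.sub_add_cancel hj.le, hx.2.1, show κ - j + i + j = i + κ by omega,
      iterate_add_apply, hx.2.1] at this
  · rw [← iterate_add_apply]
    exact hx.iterate_ne (Nat.zero_lt_of_lt hj) _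

theorem exists_of_isPeriodicPt {y : ℝ} {n : ℕ} (hn : 0 < n) (hy : y ∈ Icc (0 : ℝ) 1)
    (hper : IsPeriodicPt f n y) (hfree : ∀ i < n, f^[i] y ≠ c) :
    ∃ p, 0 < p ∧ p ≤ n ∧ IsCFreePeriodic f c y p :=
  ⟨minimalPeriod f y, hper.minimalPeriod_pos hn, hper.minimalPeriod_le hn, hy,
    iterate_minimalPeriod, fun _ hi hlt =>
      not_isPeriodicPt_of_pos_of_lt_minimalPeriod hi.ne' hlt,
    fun i hi => hfree i (hi.trans_le (hper.minimalPeriod_le hn))⟩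

/-- An expanding Lorenz map has no `c`-free fixed point of `f^[n]`, `0 < n < κ`, if it has no
`c`-free periodic point of period less than `κ`. -/
theorem iterate_ne_self (hmin : ∀ p : ℕ, 0 < p → p < κ → ∀ y : ℝ, ¬ IsCFreePeriodic f c y p)
    {y : ℝ} {n : ℕ} (hn : 0 < n) (hnκ : n < κ) (hy : y ∈ Icc (0 : ℝ) 1)
    (hfree : ∀ i < n, f^[i] y ≠ c) : f^[n] y ≠ y := fun h =>
  let ⟨p, hp, hpn, hper⟩ := exists_of_isPeriodicPt hn hy h hfree
  hmin p hp (hpn.trans_lt hnκ) y hper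

theorem hitTime_Ioo_left (hf : IsExpandingLorenz f c) (hκ : 0 < κ)
    (hmin : ∀ p : ℕ, 0 < p → p < κ → ∀ y : ℝ, ¬ IsCFreePeriodic f c y p)
    (hx : IsCFreePeriodic f c x κ) (hxc : x < c)
    (hclosest : ∀ i, f^[i] x < c → f^[i] x ≤ x) : hitTime f c (Ioo x c) = κ := by
  obtain ⟨lam, hlam, hexp⟩ := hf.exists_expansion
  have hx0 : 0 ≤ x := hx.1.1
  have hc1 : c < 1 := hf.c_lt_b
  have hfree : ∀ n, (∀ i < n, ∀ w ∈ Ioo x c, f^[i] w ≠ c) → ∀ z < c, ∀ i < n, ∀ w ∈ Icc x z,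
      f^[i] w ≠ c := by
    intro n h z hz i hi w hw
    rcases hw.1.eq_or_lt with rfl | hlt
    · exact hx.iterate_ne hκ i
    · exact h i hi w ⟨hlt, hw.2.trans_lt hz⟩
  have hlow : ∀ n < κ, ∀ z ∈ Ioo x c, f^[n] z ≠ c := by
    intro n
    induction n using Nat.strong_induction_on with
    | _ n ih =>
    intro hn z hz hzn
    rcases n.eq_zero_or_pos with rfl | hpos
    · exact hz.2.ne hzn
    have hfr := hfree n (fun i hi => ih i hi (hi.trans hn)) z hz.2
    obtain ⟨hcont, hle⟩ := hexp n x z hx0 hz.1.le (hz.2.trans hc1).le hfr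
    have hgap : 0 < lam ^ n * (z - x) :=
      mul_pos (pow_pos (zero_lt_one.trans hlam) n) (sub_pos.2 hz.1)
    have hxn : f^[n] x ≤ x := hclosest n (by linarith)
    obtain ⟨y, hy, hy0⟩ := intermediate_value_Icc hz.1.le (hcont.sub continuousOn_id)
      (show (0 : ℝ) ∈ Icc (f^[n] x - x) (f^[n] z - z) from
        ⟨by linarith, by linarith [hz.2]⟩)
    exact iterate_ne_self hmin hpos hn ⟨hx0.trans hy.1, hy.2.trans (hz.2.trans hc1).le⟩
      (fun i hi => hfr i hi y hy) (sub_eq_zero.1 hy0)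
  refine IsLeast.csInf_eq ⟨?_, ?_⟩
  · have hlam0 : 0 < lam := zero_lt_one.trans hlam
    set y := x + (c - x) / lam with hy
    have hxy : x < y := lt_add_of_pos_right x (div_pos (sub_pos.2 hxc) hlam0)
    have hyc : y < c := by
      have := div_lt_self (sub_pos.2 hxc) hlam
      linarith
    obtain ⟨hcont, hle⟩ := hexp κ x y hx0 hxy.le (hyc.trans hc1).le (hfree κ hlow y hyc)
    have hpow : lam * (y - x) ≤ lam ^ κ * (y - x) :=
      mul_le_mul_of_nonneg_right (le_self_pow₀ hlam.le hκ.ne') (sub_pos.2 hxy).le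
    have hmul : lam * (y - x) = c - x := by
      rw [hy]
      field_simp
      ring
    rw [hx.2.1] at hle
    obtain ⟨w, hw, hwc⟩ := intermediate_value_Icc hxy.le hcont
      (show c ∈ Icc (f^[κ] x) (f^[κ] y) from ⟨by rw [hx.2.1]; exact hxc.le, by linarith⟩)
    refine ⟨w, ⟨hw.1.lt_of_ne ?_, hw.2.trans_lt hyc⟩, hwc⟩
    rintro rfl
    exact hx.iterate_ne hκ κ hwc
  · rintro n ⟨z, hz, hzn⟩
    exact not_lt.1 fun hn => hlow n hn z hz hzn

theorem hitTime_Ioo_right (hf : IsExpandingLorenz f c) (hκ : 0 < κ)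
    (hmin : ∀ p : ℕ, 0 < p → p < κ → ∀ y : ℝ, ¬ IsCFreePeriodic f c y p)
    (hx : IsCFreePeriodic f c x κ) (hxc : c < x)
    (hclosest : ∀ i, c < f^[i] x → x ≤ f^[i] x) : hitTime f c (Ioo c x) = κ := by
  obtain ⟨lam, hlam, hexp⟩ := hf.exists_expansion
  have hx1 : x ≤ 1 := hx.1.2
  have hc0 : 0 < c := hf.a_lt_c
  have hfree : ∀ n, (∀ i < n, ∀ w ∈ Ioo c x, f^[i] w ≠ c) → ∀ z, c < z → ∀ i < n, ∀ w ∈ Icc z x,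
      f^[i] w ≠ c := by
    intro n h z hz i hi w hw
    rcases hw.2.eq_or_lt with rfl | hlt
    · exact hx.iterate_ne hκ i
    · exact h i hi w ⟨hz.trans_le hw.1, hlt⟩
  have hlow : ∀ n < κ, ∀ z ∈ Ioo c x, f^[n] z ≠ c := by
    intro n
    induction n using Nat.strong_induction_on with
    | _ n ih =>
    intro hn z hz hzn
    rcases n.eq_zero_or_pos with rfl | hpos
    · exact hz.1.ne' hzn
    have hfr := hfree n (fun i hi => ih i hi (hi.trans hn)) z hz.1
    obtain ⟨hcont, hle⟩ := hexp n z x (hc0.trans hz.1).le hz.2.le hx1 hfr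
    have hgap : 0 < lam ^ n * (x - z) :=
      mul_pos (pow_pos (zero_lt_one.trans hlam) n) (sub_pos.2 hz.2)
    have hxn : x ≤ f^[n] x := hclosest n (by linarith)
    obtain ⟨y, hy, hy0⟩ := intermediate_value_Icc hz.2.le (hcont.sub continuousOn_id)
      (show (0 : ℝ) ∈ Icc (f^[n] z - z) (f^[n] x - x) from
        ⟨by linarith [hz.1], by linarith⟩)
    exact iterate_ne_self hmin hpos hn ⟨(hc0.trans hz.1).le.trans hy.1, hy.2.trans hx1⟩
      (fun i hi => hfr i hi y hy) (sub_eq_zero.1 hy0)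
  refine IsLeast.csInf_eq ⟨?_, ?_⟩
  · have hlam0 : 0 < lam := zero_lt_one.trans hlam
    set y := x - (x - c) / lam with hy
    have hxy : y < x := sub_lt_self x (div_pos (sub_pos.2 hxc) hlam0)
    have hyc : c < y := by
      have := div_lt_self (sub_pos.2 hxc) hlam
      linarith
    obtain ⟨hcont, hle⟩ := hexp κ y x (hc0.trans hyc).le hxy.le hx1 (hfree κ hlow y hyc)
    have hpow : lam * (x - y) ≤ lam ^ κ * (x - y) :=
      mul_le_mul_of_nonneg_right (le_self_pow₀ hlam.le hκ.ne') (sub_pos.2 hxy).le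
    have hmul : lam * (x - y) = x - c := by
      rw [hy]
      field_simp
      ring
    rw [hx.2.1] at hle
    obtain ⟨w, hw, hwc⟩ := intermediate_value_Icc hxy.le hcont
      (show c ∈ Icc (f^[κ] y) (f^[κ] x) from ⟨by linarith, by rw [hx.2.1]; exact hxc.le⟩)
    refine ⟨w, ⟨hyc.trans_le hw.1, hw.2.lt_of_ne ?_⟩, hwc⟩
    rintro rfl
    exact hx.iterate_ne hκ κ hwc
  · rintro n ⟨z, hz, hzn⟩
    exact not_lt.1 fun hn => hlow n hn z hz hzn

theorem exists_iterate_lt (hf : IsExpandingLorenz f c) (hκ : 1 < κ)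
    (hx : IsCFreePeriodic f c x κ) : ∃ i < κ, f^[i] x < c := by
  by_contra! h
  refine hx.2.2.1 1 one_pos hκ (hf.mono_right.apply_eq_of_isPeriodicPt (zero_lt_one.trans hκ)
    hx.isPeriodicPt fun i => ⟨?_, (hf.mapsTo.iterate i hx.1).2⟩)
  rw [← hx.iterate_mod]
  have hi := Nat.mod_lt i (zero_lt_one.trans hκ)
  exact (h _ hi).lt_of_ne (hx.2.2.2 _ hi).symm

theorem exists_lt_iterate (hf : IsExpandingLorenz f c) (hκ : 1 < κ)
    (hx : IsCFreePeriodic f c x κ) : ∃ i < κ, c < f^[i] x := by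
  by_contra! h
  refine hx.2.2.1 1 one_pos hκ (hf.mono_left.apply_eq_of_isPeriodicPt (zero_lt_one.trans hκ)
    hx.isPeriodicPt fun i => ⟨(hf.mapsTo.iterate i hx.1).1, ?_⟩)
  rw [← hx.iterate_mod]
  have hi := Nat.mod_lt i (zero_lt_one.trans hκ)
  exact (h _ hi).lt_of_ne (hx.2.2.2 _ hi)

theorem finite_orbit_inter (f : ℝ → ℝ) (x : ℝ) (κ : ℕ) (p : ℝ → Prop) :
    {y : ℝ | (∃ i < κ, f^[i] x = y) ∧ p y}.Finite :=
  ((finite_Iio κ).image fun i => f^[i] x).subset fun _ hy => hy.1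

end IsCFreePeriodic

/-- a `c`-free periodic orbit of minimal period `κ` straddles `c`, and
its nearest points `P_L < c < P_R` satisfy `N((P_L,c)) = N((c,P_R)) = κ`. -/
theorem minimal_orbit_hitTime
    (f : ℝ → ℝ) (c x : ℝ) (κ : ℕ) (hf : IsExpandingLorenz f c) (hκ : 1 < κ)
    (hx : IsCFreePeriodic f c x κ)
    (hmin : ∀ p : ℕ, 0 < p → p < κ → ∀ y : ℝ, ¬ IsCFreePeriodic f c y p) :
    (∃ i < κ, f^[i] x < c) ∧ (∃ i < κ, c < f^[i] x) ∧
    hitTime f c (Set.Ioo (sSup {y : ℝ | (∃ i < κ, f^[i] x = y) ∧ y < c}) c) = κ ∧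
    hitTime f c (Set.Ioo c (sInf {y : ℝ | (∃ i < κ, f^[i] x = y) ∧ c < y})) = κ := by
  have hκ0 : 0 < κ := zero_lt_one.trans hκ
  obtain ⟨i, hi, hic⟩ := hx.exists_iterate_lt hf hκ
  obtain ⟨j, hj, hjc⟩ := hx.exists_lt_iterate hf hκ
  refine ⟨⟨i, hi, hic⟩, ⟨j, hj, hjc⟩, ?_, ?_⟩
  · have hfin := IsCFreePeriodic.finite_orbit_inter f x κ (· < c)
    have hne : {y : ℝ | (∃ i < κ, f^[i] x = y) ∧ y < c}.Nonempty := ⟨_, ⟨i, hi, rfl⟩, hic⟩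
    have hmem := hne.csSup_mem hfin
    have hle := fun y hy => le_csSup (a := y) hfin.bddAbove hy
    generalize sSup {y : ℝ | (∃ i < κ, f^[i] x = y) ∧ y < c} = P at hmem hle ⊢
    obtain ⟨⟨m, hm, rfl⟩, hPc⟩ := hmem
    refine (hx.iterate hf.mapsTo hm).hitTime_Ioo_left hf hκ0 hmin hPc fun n hn => hle _ ⟨?_, hn⟩
    exact ⟨(n + m) % κ, Nat.mod_lt _ hκ0, by rw [hx.iterate_mod, iterate_add_apply]⟩
  · have hfin := IsCFreePeriodic.finite_orbit_inter f x κ (c < ·)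
    have hne : {y : ℝ | (∃ i < κ, f^[i] x = y) ∧ c < y}.Nonempty := ⟨_, ⟨j, hj, rfl⟩, hjc⟩
    have hmem := hne.csInf_mem hfin
    have hle := fun y hy => csInf_le (a := y) hfin.bddBelow hy
    generalize sInf {y : ℝ | (∃ i < κ, f^[i] x = y) ∧ c < y} = P at hmem hle ⊢
    obtain ⟨⟨m, hm, rfl⟩, hPc⟩ := hmem
    refine (hx.iterate hf.mapsTo hm).hitTime_Ioo_right hf hκ0 hmin hPc fun n hn => hle _ ⟨?_, hn⟩
    exact ⟨(n + m) % κ, Nat.mod_lt _ hκ0, by rw [hx.iterate_mod, iterate_add_apply]⟩
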